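/- Forward direction of the NP-hardness reduction: if there exists an injective function f : α → β such that for all x y : α, G.Adj x y ↔ H.Adj (f x) (f y) (i.e., G is isomorphic to an induced subgraph of H), then enc₁(G) is a maximal common generalization of {enc₁(G), enc₂(H)}: enc₁(G) ⪯ enc₁(G), enc₁(G) ⪯ enc₂(H), and every common generalization of {enc₁(G), enc₂(H)} has cardinality at most |enc₁(G)|. -/

import Mathlib

open FirstOrder Language Sum

/-- The function symbols of the reduction language: a unary `node` and a binary `edge`. -/
inductive NEFunc : ℕ → Type
  | node : NEFunc 1
  | edge : NEFunc 2

/-- The first-order language with one unary function symbol `node` and one binary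
function symbol `edge` (and no relation symbols). -/
def L' : Language := ⟨NEFunc, fun _ => Empty⟩

attribute [local instance] Classical.propDecidable

/-- The term `node(v)`. -/
def nodeT {W : Type*} (v : W) : L'.Term W := Term.func NEFunc.node ![Term.var v]

/-- The term `edge(v, w)`. -/
def edgeT {W : Type*} (v w : W) : L'.Term W :=
  Term.func NEFunc.edge ![Term.var v, Term.var w]

/-- The goal `{node(inl x) | x : α} ∪ {edge(inl x, inl y) | G.Adj x y}` encoding the
first graph over variables `α ⊕ β`. -/
noncomputable def enc₁ {α : Type*} (β : Type*) [Fintype α] (G : SimpleGraph α) :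
    Finset (L'.Term (α ⊕ β)) :=
  (Finset.univ.image fun x : α => nodeT (inl x : α ⊕ β)) ∪
    ((Finset.univ.filter fun p : α × α => G.Adj p.1 p.2).image
      fun p => edgeT (inl p.1 : α ⊕ β) (inl p.2))

/-- The goal `{node(inr u) | u : β} ∪ {edge(inr u, inr w) | H.Adj u w}` encoding the
second graph over variables `α ⊕ β`. -/
noncomputable def enc₂ (α : Type*) {β : Type*} [Fintype β] (H : SimpleGraph β) :
    Finset (L'.Term (α ⊕ β)) :=
  (Finset.univ.image fun u : β => nodeT (inr u : α ⊕ β)) ∪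
    ((Finset.univ.filter fun p : β × β => H.Adj p.1 p.2).image
      fun p => edgeT (inr p.1 : α ⊕ β) (inr p.2))

/-- A goal `G` is more general than `G'` (`G ⪯ G'`) if some injective renaming `ρ` maps
`G` into `G'`. -/
def MoreGeneral {W : Type*} (G G' : Finset (L'.Term W)) : Prop :=
  ∃ ρ : W → W, Function.Injective ρ ∧ G.image (Term.relabel ρ) ⊆ G'

theorem relabel_nodeT {W X : Type*} (ρ : W → X) (v : W) :
    (nodeT v).relabel ρ = nodeT (ρ v) := by
  refine congrArg (Term.func _) (funext fun i => ?_)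
  fin_cases i
  rfl

theorem relabel_edgeT {W X : Type*} (ρ : W → X) (v w : W) :
    (edgeT v w).relabel ρ = edgeT (ρ v) (ρ w) := by
  refine congrArg (Term.func _) (funext fun i => ?_)
  fin_cases i <;> rfl

theorem relabel_injective {L : Language} {W X : Type*} {ρ : W → X}
    (hρ : Function.Injective ρ) :
    Function.Injective (Term.relabel ρ : L.Term W → L.Term X) := by
  intro s
  induction s with
  | var v =>
    intro t h
    cases t with
    | var w => simpa [Term.relabel, hρ.eq_iff] using h
    | func g us => simp [Term.relabel] at h
  | func F ts ih =>
    intro t h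
    cases t with
    | var w => simp [Term.relabel] at h
    | func g us =>
      simp only [Term.relabel, Term.func.injEq] at h
      obtain ⟨rfl, hF, hts⟩ := h
      cases hF
      congr 1
      funext i
      exact ih i (congrFun (eq_of_heq hts) i)

theorem MoreGeneral.refl {W : Type*} (K : Finset (L'.Term W)) : MoreGeneral K K :=
  ⟨id, Function.injective_id, by simp⟩

theorem MoreGeneral.card_le {W : Type*} {K K' : Finset (L'.Term W)} (h : MoreGeneral K K') :
    K.card ≤ K'.card := by
  obtain ⟨ρ, hρ, hK⟩ := h
  rw [← Finset.card_image_of_injective K (relabel_injective hρ)]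
  exact Finset.card_le_card hK

/-- An injection `α → β` extends to an injective renaming of `α ⊕ β` that sends the left
summand into the right one. -/
theorem exists_injective_sum_extension {α β : Type*} {f : α → β} (hf : Function.Injective f) :
    ∃ ρ : α ⊕ β → α ⊕ β, Function.Injective ρ ∧ ∀ x, ρ (inl x) = inr (f x) := by
  refine ⟨Sum.elim (inr ∘ f)
    (fun u => if h : ∃ x, f x = u then inl h.choose else inr u), ?_, fun _ => rfl⟩
  refine Function.Injective.sumElim (inr_injective.comp hf) ?_ ?_
  · intro u w h
    dsimp only at h
    split_ifs at h with hu hw hw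
    · rw [← hu.choose_spec, ← hw.choose_spec, inl_injective h]
    · exact inr_injective h
  · intro x u h
    dsimp only [Function.comp_apply] at h
    split_ifs at h with hu
    exact hu ⟨x, inr_injective h⟩

theorem moreGeneral_enc₁_enc₂ {α β : Type*} [Fintype α] [Fintype β]
    {G : SimpleGraph α} {H : SimpleGraph β} {f : α → β} (hf : Function.Injective f)
    (hadj : ∀ x y, G.Adj x y → H.Adj (f x) (f y)) :
    MoreGeneral (enc₁ β G) (enc₂ α H) := by
  obtain ⟨ρ, hρ, hinl⟩ := exists_injective_sum_extension hf
  refine ⟨ρ, hρ, fun t ht => ?_⟩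
  simp only [enc₁, enc₂, Finset.mem_image, Finset.mem_union, Finset.mem_filter,
    Finset.mem_univ, true_and] at ht ⊢
  obtain ⟨s, ⟨x, rfl⟩ | ⟨p, hp, rfl⟩, rfl⟩ := ht
  · exact Or.inl ⟨f x, by rw [relabel_nodeT, hinl]⟩
  · exact Or.inr ⟨(f p.1, f p.2), hadj _ _ hp, by rw [relabel_edgeT, hinl, hinl]⟩

/-- Forward direction of the NP-hardness reduction: if `G` is isomorphic to an induced
subgraph of `H`, then `enc₁ G` is a maximal common generalization of `{enc₁ G, enc₂ H}`. -/
theorem reduction_forward {α β : Type*} [Fintype α] [Fintype β]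
    (G : SimpleGraph α) (H : SimpleGraph β)
    (h : ∃ f : α → β, Function.Injective f ∧
        ∀ x y : α, G.Adj x y ↔ H.Adj (f x) (f y)) :
    MoreGeneral (enc₁ β G) (enc₁ β G) ∧
    MoreGeneral (enc₁ β G) (enc₂ α H) ∧
    ∀ K : Finset (L'.Term (α ⊕ β)),
      (∀ S ∈ ({enc₁ β G, enc₂ α H} : Set (Finset (L'.Term (α ⊕ β)))), MoreGeneral K S) →
      K.card ≤ (enc₁ β G).card := by
  obtain ⟨f, hf, hadj⟩ := h
  exact ⟨MoreGeneral.refl _, moreGeneral_enc₁_enc₂ hf fun x y => (hadj x y).mp,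
    fun K hK => (hK _ (Set.mem_insert _ _)).card_le⟩
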